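/- Let M be an o-minimal structure, let (X,≼) be a definable totally preordered set with X ⊆ M^k, and let l be a natural number. Let S be a definable family of nonempty subsets of X, each of which is a finite union of at most l ≼-intervals (including degenerate ones) with endpoints in X ∪ {−∞,+∞}. Then exactly one of the following holds: (1) S has a finite tame transversal, i.e., S can be covered by finitely many subfamilies, each of which extends to a definable type; (2) there exists an infinite subfamily of S (not necessarily definable) of pairwise disjoint sets. -/

import Mathlib

open FirstOrder Set

/-- `M` is an o-minimal `L`-structure: a densely linearly ordered structure without endpoints,
whose order is `∅`-definable, and in which every definable (with parameters) subset of `M`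
is a finite union of points and open intervals with endpoints in `M ∪ {±∞}`. -/
def IsOMinimal (L : FirstOrder.Language) (M : Type*) [L.Structure M] [LinearOrder M] : Prop :=
  Nonempty M ∧ DenselyOrdered M ∧ NoMinOrder M ∧ NoMaxOrder M ∧
  Set.Definable (∅ : Set M) L {v : Fin 2 → M | v 0 < v 1} ∧
  ∀ s : Set M, Set.Definable₁ (Set.univ : Set M) L s →
    ∃ F : Finset (Set M), s = ⋃₀ (F : Set (Set M)) ∧
      ∀ t ∈ F, (∃ a : M, t = {a}) ∨ (∃ a b : M, t = Set.Ioo a b) ∨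
        (∃ a : M, t = Set.Ioi a) ∨ (∃ a : M, t = Set.Iio a) ∨ t = Set.univ

/-- The fiber over `u` of a set `D ⊆ M^{m+n}`, i.e. the set `φ(u, M^n)`. -/
def famFiber {M : Type*} {m n : ℕ} (D : Set (Fin m ⊕ Fin n → M)) (u : Fin m → M) :
    Set (Fin n → M) :=
  {v | Sum.elim u v ∈ D}

/-- An `A`-definable family of subsets of `M^n`: the family of fibers `φ(u, M^n)` for `u`
ranging over an `A`-definable index set `Ω`, where `φ` is `A`-definable. -/
def IsDefFamily (L : FirstOrder.Language) {M : Type*} [L.Structure M] (A : Set M) (n : ℕ)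
    (S : Set (Set (Fin n → M))) : Prop :=
  ∃ (m : ℕ) (Ω : Set (Fin m → M)) (D : Set (Fin m ⊕ Fin n → M)),
    Set.Definable A L Ω ∧ Set.Definable A L D ∧ S = famFiber D '' Ω

/-- A family of sets is downward directed: it does not contain `∅` and any two members
contain a common member. -/
def DirectedFam {α : Type*} (S : Set (Set α)) : Prop :=
  ∅ ∉ S ∧ ∀ X ∈ S, ∀ Y ∈ S, ∃ Z ∈ S, Z ⊆ X ∩ Y

/-- `S` is finer than `F`: every member of `F` contains a member of `S`. -/
def FinerThan {α : Type*} (S F : Set (Set α)) : Prop :=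
  ∀ X ∈ F, ∃ Y ∈ S, Y ⊆ X

/-- A (complete) `n`-type over `M`: an ultrafilter on the Boolean algebra of definable
subsets of `M^n`. -/
def IsTypeOn (L : FirstOrder.Language) {M : Type*} [L.Structure M] (n : ℕ)
    (p : Set (Set (Fin n → M))) : Prop :=
  (∀ X ∈ p, Set.Definable (Set.univ : Set M) L X) ∧
  ∅ ∉ p ∧
  (∀ X ∈ p, ∀ Y ∈ p, X ∩ Y ∈ p) ∧
  (∀ X ∈ p, ∀ Y : Set (Fin n → M), Set.Definable (Set.univ : Set M) L Y → X ⊆ Y → Y ∈ p) ∧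
  (∀ X : Set (Fin n → M), Set.Definable (Set.univ : Set M) L X → X ∈ p ∨ Xᶜ ∈ p)

/-- A type `p` is `A`-definable if for every `∅`-definable `D ⊆ M^{m+n}` the set of
parameters `u` with `φ(u, M^n) ∈ p` is `A`-definable. -/
def IsDefTypeOver (L : FirstOrder.Language) {M : Type*} [L.Structure M] (A : Set M) (n : ℕ)
    (p : Set (Set (Fin n → M))) : Prop :=
  ∀ (m : ℕ) (D : Set (Fin m ⊕ Fin n → M)), Set.Definable (∅ : Set M) L D →
    Set.Definable A L {u : Fin m → M | famFiber D u ∈ p}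

/-- A family `F` is complete for a family `X` if each member of `X` either contains a member
of `F` or is disjoint from one. -/
def CompleteFor {α : Type*} (F X : Set (Set α)) : Prop :=
  ∀ Y ∈ X, ∃ Z ∈ F, Z ⊆ Y ∨ Z ∩ Y = ∅

/-- A family of subsets of `M^n` is complete if it decides every definable set. -/
def IsCompleteFam (L : FirstOrder.Language) {M : Type*} [L.Structure M] (n : ℕ)
    (S : Set (Set (Fin n → M))) : Prop :=
  ∀ X : Set (Fin n → M), Set.Definable (Set.univ : Set M) L X → ∃ Z ∈ S, Z ⊆ X ∨ Z ∩ X = ∅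

/-- `B` is a basis for the type `p`: a downward directed subfamily generating `p`. -/
def IsBasisOfType {α : Type*} (B p : Set (Set α)) : Prop :=
  B ⊆ p ∧ DirectedFam B ∧ ∀ Y ∈ p, ∃ Z ∈ B, Z ⊆ Y

/-- `p` has an `A`-definable basis. -/
def HasDefBasis (L : FirstOrder.Language) {M : Type*} [L.Structure M] (A : Set M) (n : ℕ)
    (p : Set (Set (Fin n → M))) : Prop :=
  ∃ B, IsDefFamily L A n B ∧ IsBasisOfType B p

/-- `S` has a finite tame transversal: it is covered by finitely many subfamilies, each of
which extends to a definable type. -/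
def HasFTT (L : FirstOrder.Language) {M : Type*} [L.Structure M] (n : ℕ)
    (S : Set (Set (Fin n → M))) : Prop :=
  ∃ (N : ℕ) (p : Fin N → Set (Set (Fin n → M))),
    (∀ i, IsTypeOn L n (p i) ∧ IsDefTypeOver L (Set.univ : Set M) n (p i)) ∧
    ∀ X ∈ S, ∃ i, X ∈ p i

/-- The `(m,n)`-property: among any `m` members of the family, some `n` have nonempty
intersection. -/
def HasMNProperty {α : Type*} (S : Set (Set α)) (m n : ℕ) : Prop :=
  ∀ F : Finset (Set α), ↑F ⊆ S → F.card = m →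
    ∃ G ⊆ F, G.card = n ∧ (⋂₀ (G : Set (Set α))).Nonempty

/-- A left-hand condition for a `≼`-interval: no condition (`-∞`), or `x ≼ z`, or `x ≺ z`
for some `x ∈ X`. -/
def LeftRayCond {M : Type*} {k : ℕ} (X : Set (Fin k → M))
    (r : (Fin k → M) → (Fin k → M) → Prop) (c : Set (Fin k → M)) : Prop :=
  c = Set.univ ∨ (∃ x ∈ X, c = {z | r x z}) ∨ (∃ x ∈ X, c = {z | r x z ∧ ¬ r z x})

/-- A right-hand condition for a `≼`-interval: no condition (`+∞`), or `z ≼ y`, or `z ≺ y`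
for some `y ∈ X`. -/
def RightRayCond {M : Type*} {k : ℕ} (X : Set (Fin k → M))
    (r : (Fin k → M) → (Fin k → M) → Prop) (c : Set (Fin k → M)) : Prop :=
  c = Set.univ ∨ (∃ y ∈ X, c = {z | r z y}) ∨ (∃ y ∈ X, c = {z | r z y ∧ ¬ r y z})

/-- A `≼`-interval in `X` with endpoints in `X ∪ {-∞, +∞}`. -/
def PreorderInterval {M : Type*} {k : ℕ} (X : Set (Fin k → M))
    (r : (Fin k → M) → (Fin k → M) → Prop) (I : Set (Fin k → M)) : Prop :=
  ∃ c d : Set (Fin k → M), LeftRayCond X r c ∧ RightRayCond X r d ∧ I = X ∩ c ∩ d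


section Calculus

/-- A predicate on tuples that is definable with parameters. -/
def Dfn (L : FirstOrder.Language) {M : Type*} [L.Structure M] {α : Type} (P : (α → M) → Prop) :
    Prop :=
  Set.Definable (Set.univ : Set M) L {v | P v}

/-- Coordinate functions and constants. -/
def IsTm {M : Type*} {α : Type} (g : (α → M) → M) : Prop :=
  (∃ a, ∀ v, g v = v a) ∨ ∃ c, ∀ v, g v = c

/-- Tuples of coordinate functions and constants. -/
def TMap {M : Type*} {α β : Type} (g : (α → M) → (β → M)) : Prop := ∀ b, IsTm (fun v => g v b)

theorem TMap.sum {M : Type*} {α β γ : Type} {g : (α → M) → (β → M)} {h : (α → M) → (γ → M)}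
    (hg : TMap g) (hh : TMap h) : TMap (fun v => Sum.elim (g v) (h v)) := by
  rintro (b | b)
  · exact hg b
  · exact hh b

theorem TMap.const {M : Type*} {α β : Type} (c : β → M) : TMap (fun _ : α → M => c) :=
  fun b => Or.inr ⟨c b, fun _ => rfl⟩

theorem TMap.id {M : Type*} {α : Type} : TMap (fun v : α → M => v) :=
  fun b => Or.inl ⟨b, fun _ => rfl⟩

theorem TMap.comp {M : Type*} {α β γ : Type} {g : (α → M) → (β → M)} (hg : TMap g) (f : γ → β) :
    TMap (fun v => g v ∘ f) := fun b => hg (f b)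

theorem TMap.left {M : Type*} {α β γ : Type} {g : (α → M) → (β → M)} (hg : TMap g) :
    TMap (fun v : α ⊕ γ → M => g (v ∘ Sum.inl)) := by
  intro b
  rcases hg b with ⟨a, h⟩ | ⟨c, h⟩
  · exact Or.inl ⟨Sum.inl a, fun v => h _⟩
  · exact Or.inr ⟨c, fun v => h _⟩

theorem TMap.cons {M : Type*} {α : Type} {n : ℕ} {t : (α → M) → M} {w : (α → M) → (Fin n → M)}
    (ht : IsTm t) (hw : TMap w) :
    TMap (fun v => (Fin.cons (t v) (w v) : Fin (n + 1) → M)) := by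
  intro b
  refine Fin.cases ?_ (fun i => ?_) b
  · exact ht
  · exact hw i

theorem IsTm.v {M : Type*} {γ : Type} (a : γ) : IsTm (fun z : γ → M => z a) :=
  Or.inl ⟨a, fun _ => rfl⟩

variable {L : FirstOrder.Language} {M : Type*} [L.Structure M] {α β γ : Type}

theorem Dfn.subst {P : (β → M) → Prop} (hP : Dfn L P) {g : (α → M) → (β → M)} (hg : TMap g) :
    Dfn L (fun v => P (g v)) := by
  classical
  obtain ⟨φ, hφ⟩ := hP
  have : ∀ b, ∃ t : (L[[(Set.univ : Set M)]]).Term α, ∀ v, t.realize v = g v b := by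
    intro b
    rcases hg b with ⟨a, h⟩ | ⟨c, h⟩
    · exact ⟨Language.Term.var a, fun v => (h v).symm⟩
    · refine ⟨(L.con (⟨c, Set.mem_univ c⟩ : (Set.univ : Set M))).term, fun v => ?_⟩
      have h' : g v b = c := h v
      rw [h']
      simp
  choose t ht using this
  refine ⟨Language.BoundedFormula.subst φ t, ?_⟩
  ext v
  have h1 : P (g v) ↔ φ.Realize (g v) := by
    have := Set.ext_iff.1 hφ (g v)
    exact this
  show P (g v) ↔ Language.BoundedFormula.Realize (Language.BoundedFormula.subst φ t) v default
  rw [h1, Language.BoundedFormula.realize_subst]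
  simp only [ht]
  rfl

theorem Dfn.congr {P Q : (α → M) → Prop} (hP : Dfn L P) (h : ∀ v, P v ↔ Q v) : Dfn L Q := by
  have : P = Q := funext fun v => propext (h v)
  exact this ▸ hP

theorem Dfn.and {P Q : (α → M) → Prop} (hP : Dfn L P) (hQ : Dfn L Q) :
    Dfn L (fun v => P v ∧ Q v) := Set.Definable.inter hP hQ

theorem Dfn.or {P Q : (α → M) → Prop} (hP : Dfn L P) (hQ : Dfn L Q) :
    Dfn L (fun v => P v ∨ Q v) := Set.Definable.union hP hQ

theorem Dfn.not {P : (α → M) → Prop} (hP : Dfn L P) : Dfn L (fun v => ¬ P v) :=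
  Set.Definable.compl hP

theorem Dfn.imp {P Q : (α → M) → Prop} (hP : Dfn L P) (hQ : Dfn L Q) :
    Dfn L (fun v => P v → Q v) := (hP.not.or hQ).congr fun _ => imp_iff_not_or.symm

theorem Dfn.prop (p : Prop) : Dfn L (fun _ : α → M => p) := by
  by_cases h : p
  · exact Dfn.congr (P := fun v => v ∈ (Set.univ : Set (α → M))) Set.definable_univ
      fun v => by simp [h]
  · exact Dfn.congr (P := fun v => v ∈ (∅ : Set (α → M))) Set.definable_empty
      fun v => by simp [h]

theorem Dfn.ex [Finite β] {P : (α → M) → (β → M) → Prop}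
    (hP : Dfn L (fun z : α ⊕ β → M => P (z ∘ Sum.inl) (z ∘ Sum.inr))) :
    Dfn L (fun v => ∃ w, P v w) := Set.Definable.exists_of_finite hP

theorem Dfn.all [Finite β] {P : (α → M) → (β → M) → Prop}
    (hP : Dfn L (fun z : α ⊕ β → M => P (z ∘ Sum.inl) (z ∘ Sum.inr))) :
    Dfn L (fun v => ∀ w, P v w) := Set.Definable.forall_of_finite hP

theorem Dfn.ex1 {P : (α → M) → M → Prop}
    (hP : Dfn L (fun z : α ⊕ Fin 1 → M => P (z ∘ Sum.inl) (z (Sum.inr 0)))) :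
    Dfn L (fun v => ∃ t, P v t) := by
  have : Dfn L (fun v => ∃ w : Fin 1 → M, P v (w 0)) := Dfn.ex hP
  exact this.congr fun v => ⟨fun ⟨w, h⟩ => ⟨w 0, h⟩, fun ⟨t, h⟩ => ⟨fun _ => t, h⟩⟩

theorem Dfn.all1 {P : (α → M) → M → Prop}
    (hP : Dfn L (fun z : α ⊕ Fin 1 → M => P (z ∘ Sum.inl) (z (Sum.inr 0)))) :
    Dfn L (fun v => ∀ t, P v t) := by
  have : Dfn L (fun v => ∀ w : Fin 1 → M, P v (w 0)) := Dfn.all hP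
  exact this.congr fun v => ⟨fun h t => h (fun _ => t), fun h w => h _⟩

theorem Dfn.allFin {ι : Type} [Finite ι] {P : ι → (α → M) → Prop} (h : ∀ i, Dfn L (P i)) :
    Dfn L (fun v => ∀ i, P i v) := by
  have := Set.definable_iInter_of_finite (L := L) (A := (Set.univ : Set M)) h
  exact Dfn.congr (P := fun v => v ∈ ⋂ i, {v | P i v}) this fun v => by simp

theorem Dfn.sub2 {P : (α → M) → (β → M) → Prop}
    (hP : Dfn L (fun z : α ⊕ β → M => P (z ∘ Sum.inl) (z ∘ Sum.inr)))
    {g : (γ → M) → (α → M)} {h : (γ → M) → (β → M)} (hg : TMap g) (hh : TMap h) :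
    Dfn L (fun z => P (g z) (h z)) :=
  hP.subst (hg.sum hh)

theorem Dfn.sub21 {P : (α → M) → M → Prop}
    (hP : Dfn L (fun z : α ⊕ Fin 1 → M => P (z ∘ Sum.inl) (z (Sum.inr 0))))
    {g : (γ → M) → (α → M)} {h : (γ → M) → M} (hg : TMap g) (hh : IsTm h) :
    Dfn L (fun z => P (g z) (h z)) :=
  hP.subst (g := fun z => Sum.elim (g z) (fun _ : Fin 1 => h z)) (hg.sum fun _ => hh)

end Calculus

section Types

/-- Proper filters of sets. -/
structure PF {T : Type*} (p : Set (Set T)) : Prop where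
  mono : ∀ X ∈ p, ∀ Y, X ⊆ Y → Y ∈ p
  inter : ∀ X ∈ p, ∀ Y ∈ p, X ∩ Y ∈ p
  nemp : ∅ ∉ p

variable {L : FirstOrder.Language} {M : Type*} [L.Structure M] [LinearOrder M]

theorem dec1 (hM : IsOMinimal L M) {p : Set (Set M)} (hp : PF p)
    (h : ∀ x, Ioi x ∈ p ∨ Iio x ∈ p ∨ {x} ∈ p) (W : Set M)
    (hW : Dfn L (fun v : Fin 1 → M => v 0 ∈ W)) : W ∈ p ∨ Wᶜ ∈ p := by
  classical
  obtain ⟨⟨x0⟩, -, -, -, -, hom⟩ := hM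
  have huniv : univ ∈ p := by
    rcases h x0 with h | h | h <;> exact hp.mono _ h _ (subset_univ _)
  have hIoi : ∀ a, Ioi a ∈ p ∨ (Ioi a)ᶜ ∈ p := by
    intro a
    rcases h a with h | h | h
    · exact Or.inl h
    · exact Or.inr (hp.mono _ h _ fun x hx => by simpa using le_of_lt hx)
    · exact Or.inr (hp.mono _ h _ fun x hx => by simp at hx; simp [hx])
  have hIio : ∀ a, Iio a ∈ p ∨ (Iio a)ᶜ ∈ p := by
    intro a
    rcases h a with h | h | h
    · exact Or.inr (hp.mono _ h _ fun x hx => by simpa using le_of_lt hx)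
    · exact Or.inl h
    · exact Or.inr (hp.mono _ h _ fun x hx => by simp at hx; simp [hx])
  obtain ⟨F, rfl, hF⟩ := hom W hW
  have hdec : ∀ t ∈ F, t ∈ p ∨ tᶜ ∈ p := by
    intro t ht
    rcases hF t ht with ⟨a, rfl⟩ | ⟨a, b, rfl⟩ | ⟨a, rfl⟩ | ⟨a, rfl⟩ | rfl
    · rcases h a with h | h | h
      · exact Or.inr (hp.mono _ h _ fun x hx => by simpa using ne_of_gt hx)
      · exact Or.inr (hp.mono _ h _ fun x hx => by simpa using ne_of_lt hx)
      · exact Or.inl h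
    · rcases hIoi a with h1 | h1
      · rcases hIio b with h2 | h2
        · exact Or.inl (hp.inter _ h1 _ h2)
        · exact Or.inr (hp.mono _ h2 _ fun x hx hx' => hx hx'.2)
      · exact Or.inr (hp.mono _ h1 _ fun x hx hx' => hx hx'.1)
    · exact hIoi a
    · exact hIio a
    · exact Or.inl huniv
  by_cases hex : ∃ t ∈ F, t ∈ p
  · obtain ⟨t, htF, ht⟩ := hex
    exact Or.inl (hp.mono _ ht _ (subset_sUnion_of_mem htF))
  · push Not at hex
    right
    have key : ∀ G : Finset (Set M), G ⊆ F → (⋃₀ (G : Set (Set M)))ᶜ ∈ p := by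
      intro G
      induction G using Finset.induction_on with
      | empty => intro _; simpa using huniv
      | insert t G _ ih =>
        intro hG
        have h1 := ih fun x hx => hG (Finset.mem_insert_of_mem hx)
        have ht : t ∈ F := hG (Finset.mem_insert_self _ _)
        have h2 := (hdec t ht).resolve_left (hex t ht)
        have := hp.inter _ h2 _ h1
        simpa [compl_union] using this
    exact key F subset_rfl

theorem dfn_lt (hM : IsOMinimal L M) {γ : Type} {g h : (γ → M) → M} (hg : IsTm g) (hh : IsTm h) :
    Dfn L (fun z => g z < h z) := by
  have h0 : Dfn L (fun v : Fin 2 → M => v 0 < v 1) :=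
    Set.Definable.mono hM.2.2.2.2.1 (Set.empty_subset _)
  have hT : TMap (fun z : γ → M => (![g z, h z] : Fin 2 → M)) := by
    intro b
    fin_cases b
    · exact hg
    · exact hh
  exact h0.subst hT

theorem oned (hM : IsOMinimal L M) {α η : Type} [Finite α] [Finite η]
    (Y : (α → M) → (η → M) → Prop) (V : (α → M) → (η → M) → M → Prop)
    (hY : Dfn L (fun z : α ⊕ η → M => Y (z ∘ Sum.inl) (z ∘ Sum.inr)))
    (hV : Dfn L (fun z : (α ⊕ η) ⊕ Fin 1 → M =>
      V ((z ∘ Sum.inl) ∘ Sum.inl) ((z ∘ Sum.inl) ∘ Sum.inr) (z (Sum.inr 0))))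
    (hne : ∀ s y, Y s y → ∃ t, V s y t)
    (hdir : ∀ s y y', Y s y → Y s y' → ∃ y'', Y s y'' ∧ ∀ t, V s y'' t → V s y t ∧ V s y' t) :
    ∃ q : (α → M) → Set (Set M),
      (∀ (γ : Type) [Finite γ] (g : (γ → M) → (α → M)) (D : (γ → M) → M → Prop), TMap g →
        Dfn L (fun z : γ ⊕ Fin 1 → M => D (z ∘ Sum.inl) (z (Sum.inr 0))) →
        Dfn L (fun z => {t | D z t} ∈ q (g z))) ∧
      ∀ s, (∃ y, Y s y) → PF (q s) ∧
        (∀ W, Dfn L (fun v : Fin 1 → M => v 0 ∈ W) → W ∈ q s ∨ Wᶜ ∈ q s) ∧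
        ∀ y, Y s y → {t | V s y t} ∈ q s := by
  classical
  let A : (α → M) → M → Prop := fun s x => ∃ y, Y s y ∧ ∀ t, V s y t → x < t
  let Pt : (α → M) → M → Prop := fun s a => ¬ A s a ∧ (∀ x, x < a → A s x) ∧ ∀ y, Y s y → V s y a
  have hVs : ∀ (γ : Type) (g : (γ → M) → (α → M)) (h : (γ → M) → (η → M)) (t : (γ → M) → M),
      TMap g → TMap h → IsTm t → Dfn L (fun z => V (g z) (h z) (t z)) := by
    intro γ g h t hg hh ht
    exact hV.subst (g := fun z => Sum.elim (Sum.elim (g z) (h z)) (fun _ => t z))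
      ((hg.sum hh).sum fun _ => ht)
  have hA : Dfn L (fun z : α ⊕ Fin 1 → M => A (z ∘ Sum.inl) (z (Sum.inr 0))) := by
    refine Dfn.ex (Dfn.and ?_ (Dfn.all1 (Dfn.imp ?_ ?_)))
    · exact hY.sub2 ((TMap.id.comp _).comp _) (TMap.id.comp _)
    · exact hVs _ _ _ _ (((TMap.id.comp _).comp _).comp _) ((TMap.id.comp _).comp _) (IsTm.v _)
    · exact dfn_lt hM (IsTm.v (Sum.inl (Sum.inl (Sum.inr 0)))) (IsTm.v _)
  have hPt : Dfn L (fun z : α ⊕ Fin 1 → M => Pt (z ∘ Sum.inl) (z (Sum.inr 0))) := by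
    refine Dfn.and hA.not (Dfn.and (Dfn.all1 (Dfn.imp ?_ ?_)) (Dfn.all (Dfn.imp ?_ ?_)))
    · exact dfn_lt hM (IsTm.v _) (IsTm.v (Sum.inl (Sum.inr 0)))
    · exact hA.sub21 ((TMap.id.comp _).comp _) (IsTm.v _)
    · exact hY.sub2 ((TMap.id.comp _).comp _) (TMap.id.comp _)
    · exact hVs _ _ _ _ ((TMap.id.comp _).comp _) (TMap.id.comp _) (IsTm.v (Sum.inl (Sum.inr 0)))
  let q : (α → M) → Set (Set M) := fun s => {W | (∃ a, Pt s a ∧ a ∈ W) ∨ ((∀ a, ¬ Pt s a) ∧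
    ∃ y, Y s y ∧ ((∀ t, V s y t → t ∈ W) ∨ ∃ c, ¬ A s c ∧ ∀ t, V s y t → ¬ c < t → t ∈ W))}
  refine ⟨q, ?_, ?_⟩
  · intro γ _ g D hg hD
    refine Dfn.or (Dfn.ex1 (Dfn.and ?_ ?_)) (Dfn.and (Dfn.all1 (Dfn.not ?_)) (Dfn.ex (Dfn.and ?_
      (Dfn.or (Dfn.all1 (Dfn.imp ?_ ?_)) (Dfn.ex1 (Dfn.and (Dfn.not ?_) (Dfn.all1 (Dfn.imp ?_
        (Dfn.imp (Dfn.not ?_) ?_)))))))))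
    · exact hPt.sub21 hg.left (IsTm.v _)
    · exact hD
    · exact hPt.sub21 hg.left (IsTm.v _)
    · exact hY.sub2 hg.left (TMap.id.comp _)
    · exact hVs _ _ _ _ hg.left.left ((TMap.id.comp _).comp _) (IsTm.v _)
    · exact hD.sub21 ((TMap.id.comp _).comp _) (IsTm.v _)
    · exact hA.sub21 hg.left.left (IsTm.v _)
    · exact hVs _ _ _ _ hg.left.left.left (((TMap.id.comp _).comp _).comp _) (IsTm.v _)
    · exact dfn_lt hM (IsTm.v (Sum.inl (Sum.inr 0))) (IsTm.v _)
    · exact hD.sub21 (((TMap.id.comp _).comp _).comp _) (IsTm.v _)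
  · rintro s ⟨y0, hy0⟩
    have huniq : ∀ a b, Pt s a → Pt s b → a = b := by
      intro a b ha hb
      rcases lt_trichotomy a b with h | h | h
      · exact absurd (hb.2.1 _ h) ha.1
      · exact h
      · exact absurd (ha.2.1 _ h) hb.1
    have hmono : ∀ x x', x ≤ x' → A s x' → A s x := by
      rintro x x' hx ⟨y, hy, h⟩
      exact ⟨y, hy, fun t ht => lt_of_le_of_lt hx (h t ht)⟩
    have hVq : ∀ y, Y s y → {t | V s y t} ∈ q s := by
      intro y hy
      by_cases hP : ∃ a, Pt s a
      · obtain ⟨a, ha⟩ := hP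
        exact Or.inl ⟨a, ha, ha.2.2 y hy⟩
      · push Not at hP
        exact Or.inr ⟨hP, y, hy, Or.inl fun t ht => ht⟩
    have hpf : PF (q s) := by
      refine ⟨?_, ?_, ?_⟩
      · rintro W (⟨a, ha, haW⟩ | ⟨hP, y, hy, h | ⟨c, hc, h⟩⟩) W' hWW'
        · exact Or.inl ⟨a, ha, hWW' haW⟩
        · exact Or.inr ⟨hP, y, hy, Or.inl fun t ht => hWW' (h t ht)⟩
        · exact Or.inr ⟨hP, y, hy, Or.inr ⟨c, hc, fun t ht hct => hWW' (h t ht hct)⟩⟩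
      · rintro W (⟨a, ha, haW⟩ | ⟨hP, y, hy, h⟩) W' (⟨a', ha', haW'⟩ | ⟨hP', y', hy', h'⟩)
        · exact Or.inl ⟨a, ha, haW, huniq _ _ ha' ha ▸ haW'⟩
        · exact absurd ha (hP' a)
        · exact absurd ha' (hP a')
        · obtain ⟨y'', hy'', hd⟩ := hdir s y y' hy hy'
          refine Or.inr ⟨hP, y'', hy'', ?_⟩
          rcases h with h | ⟨c, hc, h⟩ <;> rcases h' with h' | ⟨c', hc', h'⟩
          · exact Or.inl fun t ht => ⟨h t (hd t ht).1, h' t (hd t ht).2⟩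
          · exact Or.inr ⟨c', hc', fun t ht hct => ⟨h t (hd t ht).1, h' t (hd t ht).2 hct⟩⟩
          · exact Or.inr ⟨c, hc, fun t ht hct => ⟨h t (hd t ht).1 hct, h' t (hd t ht).2⟩⟩
          · rcases le_total c c' with hcc | hcc
            · exact Or.inr ⟨c, hc, fun t ht hct => ⟨h t (hd t ht).1 hct, h' t (hd t ht).2
                fun hh => hct (lt_of_le_of_lt hcc hh)⟩⟩
            · exact Or.inr ⟨c', hc', fun t ht hct => ⟨h t (hd t ht).1
                fun hh => hct (lt_of_le_of_lt hcc hh), h' t (hd t ht).2 hct⟩⟩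
      · rintro (⟨a, ha, haW⟩ | ⟨hP, y, hy, h | ⟨c, hc, h⟩⟩)
        · exact haW
        · obtain ⟨t, ht⟩ := hne s y hy
          exact h t ht
        · exact hc ⟨y, hy, fun t ht => by_contra fun hct => h t ht hct⟩
    refine ⟨hpf, dec1 hM hpf ?_, hVq⟩
    intro x
    by_cases hP : ∃ a, Pt s a
    · obtain ⟨a, ha⟩ := hP
      rcases lt_trichotomy x a with h | h | h
      · exact Or.inl (Or.inl ⟨a, ha, h⟩)
      · exact Or.inr (Or.inr (Or.inl ⟨a, ha, h.symm⟩))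
      · exact Or.inr (Or.inl (Or.inl ⟨a, ha, h⟩))
    · push Not at hP
      by_cases hx : A s x
      · obtain ⟨y, hy, h⟩ := hx
        exact Or.inl (hpf.mono _ (hVq y hy) _ h)
      · right; left
        by_cases hc : ∃ c, c < x ∧ ¬ A s c
        · obtain ⟨c, hcx, hc⟩ := hc
          exact Or.inr ⟨hP, y0, hy0, Or.inr ⟨c, hc, fun t _ hct =>
            lt_of_le_of_lt (not_lt.1 hct) hcx⟩⟩
        · push Not at hc
          have : ∃ y, Y s y ∧ ¬ V s y x := by
            by_contra hno
            push Not at hno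
            exact hP x ⟨hx, hc, hno⟩
          obtain ⟨y, hy, hyx⟩ := this
          refine Or.inr ⟨hP, y, hy, Or.inr ⟨x, hx, fun t ht hct => ?_⟩⟩
          refine lt_of_le_of_ne (not_lt.1 hct) ?_
          rintro rfl
          exact hyx ht

end Types

section Cofinal

variable {L : FirstOrder.Language} {M : Type*} [L.Structure M] [LinearOrder M]

theorem cof (hM : IsOMinimal L M) (n : ℕ) : ∀ (α : Type) [Finite α]
    (X : (α → M) → (Fin n → M) → Prop) (R : (α → M) → (Fin n → M) → (Fin n → M) → Prop),
    Dfn L (fun z : α ⊕ Fin n → M => X (z ∘ Sum.inl) (z ∘ Sum.inr)) →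
    Dfn L (fun z : (α ⊕ Fin n) ⊕ Fin n → M =>
      R ((z ∘ Sum.inl) ∘ Sum.inl) ((z ∘ Sum.inl) ∘ Sum.inr) (z ∘ Sum.inr)) →
    (∀ s x, X s x → R s x x) →
    (∀ s x y z, X s x → X s y → X s z → R s x y → R s y z → R s x z) →
    (∀ s x y, X s x → X s y → R s x y ∨ R s y x) →
    ∃ p : (α → M) → Set (Set (Fin n → M)),
      (∀ (γ : Type) [Finite γ] (g : (γ → M) → (α → M)) (D : (γ → M) → (Fin n → M) → Prop),
        TMap g → Dfn L (fun z : γ ⊕ Fin n → M => D (z ∘ Sum.inl) (z ∘ Sum.inr)) →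
        Dfn L (fun z => {w | D z w} ∈ p (g z))) ∧
      ∀ s, (∃ x, X s x) → PF (p s) ∧
        (∀ W, Dfn L (fun v : Fin n → M => v ∈ W) → W ∈ p s ∨ Wᶜ ∈ p s) ∧
        ∀ y, X s y → {x | X s x ∧ R s y x} ∈ p s := by
  induction n with
  | zero =>
    intro α _ X R hX hR hrefl htrans htot
    refine ⟨fun _ => {W | Fin.elim0 ∈ W}, ?_, ?_⟩
    · intro γ _ g D hg hD
      exact hD.sub2 TMap.id (TMap.const Fin.elim0)
    · rintro s -
      refine ⟨⟨fun W hW Y h => h hW, fun W hW Y hY => ⟨hW, hY⟩, fun h => h⟩, ?_, ?_⟩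
      · intro W _
        exact em _
      · intro y hy
        have : y = Fin.elim0 := Subsingleton.elim _ _
        subst this
        exact ⟨hy, hrefl _ _ hy⟩
  | succ n ih =>
    intro α _ X R hX hR hrefl htrans htot
    have hRs : ∀ (γ : Type) (g : (γ → M) → (α → M)) (h t : (γ → M) → (Fin (n + 1) → M)),
        TMap g → TMap h → TMap t → Dfn L (fun z => R (g z) (h z) (t z)) := by
      intro γ g h t hg hh ht
      exact hR.subst ((hg.sum hh).sum ht)
    obtain ⟨q, hqd, hq⟩ := oned hM (fun s y => X s y)
      (fun s y t => ∃ w : Fin n → M, X s (Fin.cons t w : Fin (n + 1) → M) ∧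
        R s y (Fin.cons t w : Fin (n + 1) → M)) hX
      (by
        refine Dfn.ex (Dfn.and ?_ ?_)
        · exact hX.sub2 (((TMap.id.comp _).comp _).comp _)
            (TMap.cons (IsTm.v (Sum.inl (Sum.inr 0))) (TMap.id.comp _))
        · exact hRs _ _ _ _ (((TMap.id.comp _).comp _).comp _) (((TMap.id.comp _).comp _).comp _)
            (TMap.cons (IsTm.v (Sum.inl (Sum.inr 0))) (TMap.id.comp _)))
      (by
        intro s y hy
        refine ⟨y 0, Fin.tail y, ?_⟩
        rw [Fin.cons_self_tail]
        exact ⟨hy, hrefl _ _ hy⟩)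
      (by
        intro s y y' hy hy'
        rcases htot s y y' hy hy' with h | h
        · refine ⟨y', hy', ?_⟩
          rintro t ⟨w, hw, hr⟩
          exact ⟨⟨w, hw, htrans _ _ _ _ hy hy' hw h hr⟩, ⟨w, hw, hr⟩⟩
        · refine ⟨y, hy, ?_⟩
          rintro t ⟨w, hw, hr⟩
          exact ⟨⟨w, hw, hr⟩, ⟨w, hw, htrans _ _ _ _ hy' hy hw h hr⟩⟩)
    obtain ⟨r, hrd, hr⟩ := ih (α ⊕ Fin 1)
      (fun s w => X (s ∘ Sum.inl) (Fin.cons (s (Sum.inr 0)) w : Fin (n + 1) → M))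
      (fun s w w' => R (s ∘ Sum.inl) (Fin.cons (s (Sum.inr 0)) w : Fin (n + 1) → M)
        (Fin.cons (s (Sum.inr 0)) w' : Fin (n + 1) → M))
      (hX.sub2 ((TMap.id.comp _).comp _)
        (TMap.cons (IsTm.v (Sum.inl (Sum.inr 0))) (TMap.id.comp _)))
      (hRs _ _ _ _ (((TMap.id.comp _).comp _).comp _)
        (TMap.cons (IsTm.v (Sum.inl (Sum.inl (Sum.inr 0)))) ((TMap.id.comp _).comp _))
        (TMap.cons (IsTm.v (Sum.inl (Sum.inl (Sum.inr 0)))) (TMap.id.comp _)))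
      (fun s x hx => hrefl _ _ hx)
      (fun s x y z hx hy hz => htrans _ _ _ _ hx hy hz)
      (fun s x y hx hy => htot _ _ _ hx hy)
    refine ⟨fun s => {Y | {t | {w | (Fin.cons t w : Fin (n + 1) → M) ∈ Y} ∈
      r (Sum.elim s (fun _ => t))} ∈ q s}, ?_, ?_⟩
    · intro γ _ g D hg hD
      refine hqd γ g (fun z t => {w | D z (Fin.cons t w : Fin (n + 1) → M)} ∈
        r (Sum.elim (g z) (fun _ => t))) hg ?_
      refine hrd (γ ⊕ Fin 1) (fun z => Sum.elim (g (z ∘ Sum.inl)) (fun _ => z (Sum.inr 0)))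
        (fun z w => D (z ∘ Sum.inl) (Fin.cons (z (Sum.inr 0)) w : Fin (n + 1) → M))
        (hg.left.sum fun _ => IsTm.v _) ?_
      exact hD.sub2 ((TMap.id.comp _).comp _)
        (TMap.cons (IsTm.v (Sum.inl (Sum.inr 0))) (TMap.id.comp _))
    · rintro s ⟨y0, hy0⟩
      obtain ⟨qpf, qdec, qV⟩ := hq s ⟨y0, hy0⟩
      have hT := qV y0 hy0
      have hrT : ∀ t, (∃ w : Fin n → M, X s (Fin.cons t w : Fin (n + 1) → M)) →
          PF (r (Sum.elim s (fun _ => t))) ∧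
          (∀ W, Dfn L (fun v : Fin n → M => v ∈ W) →
            W ∈ r (Sum.elim s (fun _ => t)) ∨ Wᶜ ∈ r (Sum.elim s (fun _ => t))) ∧
          ∀ w : Fin n → M, X s (Fin.cons t w : Fin (n + 1) → M) →
            {w' : Fin n → M | X s (Fin.cons t w' : Fin (n + 1) → M) ∧
              R s (Fin.cons t w : Fin (n + 1) → M) (Fin.cons t w' : Fin (n + 1) → M)} ∈
              r (Sum.elim s (fun _ => t)) := by
        intro t ht
        exact hr (Sum.elim s (fun _ => t)) ht
      refine ⟨⟨?_, ?_, ?_⟩, ?_, ?_⟩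
      · intro Y hY Y' hYY'
        refine qpf.mono _ (qpf.inter _ hY _ hT) _ ?_
        rintro t ⟨h1, w, hw, -⟩
        exact (hrT t ⟨w, hw⟩).1.mono _ h1 _ fun w' hw' => hYY' hw'
      · intro Y hY Y' hY'
        refine qpf.mono _ (qpf.inter _ (qpf.inter _ hY _ hY') _ hT) _ ?_
        rintro t ⟨⟨h1, h2⟩, w, hw, -⟩
        exact (hrT t ⟨w, hw⟩).1.inter _ h1 _ h2
      · intro h
        have h2 := qpf.inter _ h _ hT
        refine qpf.nemp (qpf.mono _ h2 _ ?_)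
        rintro t ⟨h1, w, hw, -⟩
        exact (hrT t ⟨w, hw⟩).1.nemp h1
      · intro W hW
        have hsec : ∀ t : M, Dfn L (fun w : Fin n → M => (Fin.cons t w : Fin (n + 1) → M) ∈ W) :=
          fun t => hW.subst (TMap.cons (Or.inr ⟨t, fun _ => rfl⟩) TMap.id)
        have hdef : Dfn L (fun v : Fin 1 → M =>
            v 0 ∈ {t | {w | (Fin.cons t w : Fin (n + 1) → M) ∈ W} ∈
              r (Sum.elim s (fun _ => t))}) := by
          refine hrd (Fin 1) (fun v => Sum.elim s (fun _ => v 0))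
            (fun v w => (Fin.cons (v 0) w : Fin (n + 1) → M) ∈ W)
            ((TMap.const s).sum fun _ => IsTm.v _) ?_
          exact hW.subst (TMap.cons (IsTm.v (Sum.inl 0)) (TMap.id.comp _))
        rcases qdec _ hdef with h | h
        · exact Or.inl h
        · right
          refine qpf.mono _ (qpf.inter _ h _ hT) _ ?_
          rintro t ⟨h1, w, hw, -⟩
          exact ((hrT t ⟨w, hw⟩).2.1 _ (hsec t)).resolve_left h1
      · intro y hy
        refine qpf.mono _ (qV y hy) _ ?_
        rintro t ⟨w, hw, hyw⟩
        refine (hrT t ⟨w, hw⟩).1.mono _ ((hrT t ⟨w, hw⟩).2.2 w hw) _ ?_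
        rintro w' ⟨hw', hr'⟩
        exact ⟨hw', htrans _ _ _ _ hy hw hw' hyw hr'⟩

/-- Definable types, as proper filters deciding definable sets. -/
structure GoodT (L : FirstOrder.Language) {M : Type*} [L.Structure M] {n : ℕ}
    (p : Set (Set (Fin n → M))) : Prop where
  pf : PF p
  dec : ∀ W, Dfn L (fun v : Fin n → M => v ∈ W) → W ∈ p ∨ Wᶜ ∈ p
  dfn : ∀ (γ : Type) [Finite γ] (D : (γ → M) → (Fin n → M) → Prop),
    Dfn L (fun z : γ ⊕ Fin n → M => D (z ∘ Sum.inl) (z ∘ Sum.inr)) →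
    Dfn L (fun z => {w | D z w} ∈ p)

/-- A nonempty definable totally preordered set has a definable cofinal type. -/
theorem cofT (hM : IsOMinimal L M) {n : ℕ} (B : Set (Fin n → M))
    (r : (Fin n → M) → (Fin n → M) → Prop) (hB : Dfn L (fun v : Fin n → M => v ∈ B))
    (hr : Dfn L (fun z : Fin n ⊕ Fin n → M => r (z ∘ Sum.inl) (z ∘ Sum.inr)))
    (hrefl : ∀ x ∈ B, r x x)
    (htrans : ∀ x ∈ B, ∀ y ∈ B, ∀ z ∈ B, r x y → r y z → r x z)
    (htotal : ∀ x ∈ B, ∀ y ∈ B, r x y ∨ r y x) (hne : B.Nonempty) :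
    ∃ p, GoodT L p ∧ ∀ y ∈ B, {x | x ∈ B ∧ r y x} ∈ p := by
  obtain ⟨p, hpd, hp⟩ := cof hM n (Fin 0) (fun _ x => x ∈ B) (fun _ => r)
    (hB.subst (TMap.id.comp _)) (hr.sub2 ((TMap.id.comp _).comp _) (TMap.id.comp _))
    (fun _ => hrefl) (fun _ x y z hx hy hz => htrans x hx y hy z hz)
    (fun _ x y hx hy => htotal x hx y hy)
  obtain ⟨h1, h2, h3⟩ := hp Fin.elim0 hne
  exact ⟨p Fin.elim0, ⟨h1, h2, fun γ _ D hD => hpd γ _ D (TMap.const _) hD⟩, h3⟩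

end Cofinal

section Comb

/-- A definable totally preordered set. -/
structure DPre (L : FirstOrder.Language) {M : Type*} [L.Structure M] {k : ℕ}
    (X : Set (Fin k → M)) (r : (Fin k → M) → (Fin k → M) → Prop) : Prop where
  dX : Dfn L (fun v : Fin k → M => v ∈ X)
  dr : Dfn L (fun z : Fin k ⊕ Fin k → M => r (z ∘ Sum.inl) (z ∘ Sum.inr))
  refl : ∀ x ∈ X, r x x
  trans : ∀ x ∈ X, ∀ y ∈ X, ∀ z ∈ X, r x y → r y z → r x z
  total : ∀ x ∈ X, ∀ y ∈ X, r x y ∨ r y x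

/-- Order-convex subsets of `X`. -/
def OC {T : Type*} (X : Set T) (r : T → T → Prop) (K : Set T) : Prop :=
  K ⊆ X ∧ ∀ a ∈ K, ∀ b ∈ K, ∀ x ∈ X, r a x → r x b → x ∈ K

/-- Unions of at most `n` definable convex sets. -/
def CN (L : FirstOrder.Language) {M : Type*} [L.Structure M] {k : ℕ}
    (X : Set (Fin k → M)) (r : (Fin k → M) → (Fin k → M) → Prop) (n : ℕ)
    (J : Set (Fin k → M)) : Prop :=
  ∃ T : Finset (Set (Fin k → M)), T.card ≤ n ∧
    (∀ K ∈ T, OC X r K ∧ Dfn L (fun v : Fin k → M => v ∈ K)) ∧ J = ⋃₀ (T : Set (Set (Fin k → M)))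

/-- The first convex component. -/
def fst {T : Type*} (X : Set T) (r : T → T → Prop) (J : Set T) : Set T :=
  {x | x ∈ J ∧ ∀ z, z ∈ J → ∀ w, w ∈ X → r z w → r w x → w ∈ J}

/-- Removal of the first convex component. -/
def rst {T : Type*} (X : Set T) (r : T → T → Prop) (J : Set T) : Set T :=
  {x | x ∈ J ∧ ¬ x ∈ fst X r J}

/-- Removal of the first `j` convex components. -/
def rit {T : Type*} (X : Set T) (r : T → T → Prop) : ℕ → Set T → Set T
  | 0, J => J
  | j + 1, J => rst X r (rit X r j J)

variable {L : FirstOrder.Language} {M : Type*} [L.Structure M] {k : ℕ}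
    {X : Set (Fin k → M)} {r : (Fin k → M) → (Fin k → M) → Prop}

theorem CN.sub {n : ℕ} {J : Set (Fin k → M)} (h : CN L X r n J) : J ⊆ X := by
  obtain ⟨T, -, hT, rfl⟩ := h
  rintro x ⟨K, hK, hx⟩
  exact (hT K hK).1.1 hx

theorem fst_oc (hp : DPre L X r) {J : Set (Fin k → M)} (hJ : J ⊆ X) : OC X r (fst X r J) := by
  refine ⟨fun x hx => hJ hx.1, ?_⟩
  intro a ha b hb x hx hax hxb
  refine ⟨hb.2 a ha.1 x hx hax hxb, ?_⟩
  intro z hz w hw hzw hwx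
  exact hb.2 z hz w hw hzw (hp.trans w hw x hx b (hJ hb.1) hwx hxb)

theorem fst_low (hp : DPre L X r) {J : Set (Fin k → M)} (hJ : J ⊆ X) {x y : Fin k → M}
    (hx : x ∈ J) (hy : y ∈ fst X r J) (hxy : r x y) : x ∈ fst X r J := by
  refine ⟨hx, fun z hz w hw hzw hwx => ?_⟩
  exact hy.2 z hz w hw hzw (hp.trans w hw x (hJ hx) y (hJ hy.1) hwx hxy)

theorem exists_low (hp : DPre L X r) (T : Finset (Set (Fin k → M))) (hT : ∀ K ∈ T, K ⊆ X)
    (hne : (⋃₀ (T : Set (Set (Fin k → M)))).Nonempty) :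
    ∃ m ∈ ⋃₀ (T : Set (Set (Fin k → M))), ∀ K ∈ T, K.Nonempty → ∃ z ∈ K, r m z := by
  classical
  induction T using Finset.induction_on with
  | empty => simp at hne
  | insert K T _ ih =>
    have hT' : ∀ K ∈ T, K ⊆ X := fun K hK => hT K (Finset.mem_insert_of_mem hK)
    have hKX : K ⊆ X := hT K (Finset.mem_insert_self _ _)
    have hTX : ∀ m ∈ ⋃₀ (T : Set (Set (Fin k → M))), m ∈ X := by
      rintro m ⟨K', hK', hm⟩
      exact hT' K' hK' hm
    rw [Finset.coe_insert, sUnion_insert] at *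
    by_cases hne' : (⋃₀ (T : Set (Set (Fin k → M)))).Nonempty
    · obtain ⟨m, hm, h⟩ := ih hT' hne'
      by_cases hK : K.Nonempty
      · obtain ⟨x, hx⟩ := hK
        rcases hp.total m (hTX m hm) x (hKX hx) with hmx | hmx
        · refine ⟨m, Or.inr hm, ?_⟩
          intro K' hK' hne'
          rcases Finset.mem_insert.1 hK' with rfl | hK'
          · exact ⟨x, hx, hmx⟩
          · exact h K' hK' hne'
        · refine ⟨x, Or.inl hx, ?_⟩
          intro K' hK' hne'
          rcases Finset.mem_insert.1 hK' with rfl | hK'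
          · exact ⟨x, hx, hp.refl x (hKX hx)⟩
          · obtain ⟨z, hz, hmz⟩ := h K' hK' hne'
            exact ⟨z, hz, hp.trans x (hKX hx) m (hTX m hm) z (hT' K' hK' hz) hmx hmz⟩
      · refine ⟨m, Or.inr hm, ?_⟩
        intro K' hK' hne'
        rcases Finset.mem_insert.1 hK' with rfl | hK'
        · exact absurd hne' hK
        · exact h K' hK' hne'
    · rw [not_nonempty_iff_eq_empty] at hne'
      rw [hne', union_empty] at hne
      obtain ⟨x, hx⟩ := hne
      refine ⟨x, Or.inl hx, ?_⟩
      intro K' hK' hne2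
      rcases Finset.mem_insert.1 hK' with rfl | hK'
      · exact ⟨x, hx, hp.refl x (hKX hx)⟩
      · obtain ⟨z, hz⟩ := hne2
        have : z ∈ ⋃₀ (T : Set (Set (Fin k → M))) := ⟨K', hK', hz⟩
        rw [hne'] at this
        exact absurd this (notMem_empty z)

theorem fst_nonempty (hp : DPre L X r) {n : ℕ} {J : Set (Fin k → M)} (hJ : CN L X r n J)
    (hne : J.Nonempty) : (fst X r J).Nonempty := by
  have hJX := hJ.sub
  obtain ⟨T, -, hT, rfl⟩ := hJ
  obtain ⟨m, hm, h⟩ := exists_low hp T (fun K hK => (hT K hK).1.1) hne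
  refine ⟨m, hm, ?_⟩
  rintro z ⟨K, hK, hz⟩ w hw hzw hwm
  obtain ⟨y, hy, hmy⟩ := h K hK ⟨z, hz⟩
  exact ⟨K, hK, (hT K hK).1.2 z hz y hy w hw hzw
    (hp.trans w hw m (hJX hm) y ((hT K hK).1.1 hy) hwm hmy)⟩

theorem rst_CN (hp : DPre L X r) {n : ℕ} {J : Set (Fin k → M)} (hJ : CN L X r n J) :
    CN L X r (n - 1) (rst X r J) := by
  classical
  by_cases hne : J.Nonempty
  · have hJX := hJ.sub
    obtain ⟨y0, hy0⟩ := fst_nonempty hp hJ hne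
    obtain ⟨T, hc, hT, rfl⟩ := hJ
    set J := ⋃₀ (T : Set (Set (Fin k → M))) with hJdef
    have key : ∀ K ∈ T, ∀ y ∈ K, y ∈ fst X r J → ∀ x ∈ K, x ∈ fst X r J := by
      intro K hK y hyK hy x hx
      refine ⟨⟨K, hK, hx⟩, fun z hz w hw hzw hwx => ?_⟩
      rcases hp.total w hw y (hJX hy.1) with h | h
      · exact hy.2 z hz w hw hzw h
      · exact ⟨K, hK, (hT K hK).1.2 y hyK x hx w hw h hwx⟩
    refine ⟨T.filter (fun K => ∀ y ∈ K, ¬ y ∈ fst X r J), ?_, ?_, ?_⟩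
    · obtain ⟨K, hK, hyK⟩ := hy0.1
      have hlt : (T.filter (fun K => ∀ y ∈ K, ¬ y ∈ fst X r J)).card < T.card := by
        apply Finset.card_lt_card
        rw [Finset.filter_ssubset]
        exact ⟨K, hK, fun h => h y0 hyK hy0⟩
      omega
    · intro K hK
      exact hT K (Finset.mem_filter.1 hK).1
    · ext x
      constructor
      · rintro ⟨⟨K, hK, hx⟩, hxf⟩
        refine ⟨K, ?_, hx⟩
        simp only [Finset.coe_filter, mem_ofPred_eq]
        exact ⟨hK, fun y hy hyf => hxf (key K hK y hy hyf x hx)⟩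
      · rintro ⟨K, hK, hx⟩
        simp only [Finset.coe_filter, mem_ofPred_eq] at hK
        exact ⟨⟨K, hK.1, hx⟩, hK.2 x hx⟩
  · rw [not_nonempty_iff_eq_empty] at hne
    subst hne
    refine ⟨∅, by simp, by simp, ?_⟩
    ext x
    simp [rst]

theorem rit_CN (hp : DPre L X r) {n : ℕ} {J : Set (Fin k → M)} (hJ : CN L X r n J) (j : ℕ) :
    CN L X r (n - j) (rit X r j J) := by
  induction j with
  | zero => exact hJ
  | succ j ih =>
    have := rst_CN hp ih
    rwa [Nat.sub_sub] at this

theorem rit_sub (j : ℕ) (J : Set (Fin k → M)) : rit X r j J ⊆ J := by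
  induction j with
  | zero => exact subset_rfl
  | succ j ih => exact fun x hx => ih hx.1

theorem rit_up (hp : DPre L X r) (j : ℕ) {J : Set (Fin k → M)} (hJ : J ⊆ X) :
    ∀ x ∈ rit X r j J, ∀ y ∈ J, r x y → y ∈ rit X r j J := by
  induction j with
  | zero => exact fun x _ y hy _ => hy
  | succ j ih =>
    intro x hx y hy hxy
    refine ⟨ih x hx.1 y hy hxy, fun hyf => hx.2 ?_⟩
    exact fst_low hp ((rit_sub j J).trans hJ) hx.1 hyf hxy

/-- Definable families. -/
def DF (L : FirstOrder.Language) {M : Type*} [L.Structure M] {k : ℕ} {γ : Type}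
    (I : (γ → M) → Set (Fin k → M)) : Prop :=
  Dfn L (fun z : γ ⊕ Fin k → M => z ∘ Sum.inr ∈ I (z ∘ Sum.inl))

theorem DF.app {γ δ : Type} {I : (γ → M) → Set (Fin k → M)} (hI : DF L I)
    {g : (δ → M) → (γ → M)} {h : (δ → M) → (Fin k → M)} (hg : TMap g) (hh : TMap h) :
    Dfn L (fun z => h z ∈ I (g z)) :=
  Dfn.sub2 (P := fun a b => b ∈ I a) hI hg hh

theorem DF.rst (hp : DPre L X r) {γ : Type} {I : (γ → M) → Set (Fin k → M)} (hI : DF L I) :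
    DF L (fun u => rst X r (I u)) := by
  refine Dfn.and hI (Dfn.not (Dfn.and hI (Dfn.all (Dfn.imp ?_ (Dfn.all (Dfn.imp ?_ (Dfn.imp ?_
    (Dfn.imp ?_ ?_))))))))
  · exact hI.app ((TMap.id.comp _).comp _) (TMap.id.comp _)
  · exact hp.dX.subst (TMap.id.comp _)
  · exact hp.dr.sub2 ((TMap.id.comp _).comp _) (TMap.id.comp _)
  · exact hp.dr.sub2 (TMap.id.comp _) (((TMap.id.comp _).comp _).comp _)
  · exact hI.app (((TMap.id.comp _).comp _).comp _) (TMap.id.comp _)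

theorem DF.rit (hp : DPre L X r) {γ : Type} {I : (γ → M) → Set (Fin k → M)} (hI : DF L I) (j : ℕ) :
    DF L (fun u => rit X r j (I u)) := by
  induction j with
  | zero => exact hI
  | succ j ih => exact DF.rst hp ih

/-- Finite tame transversals. -/
def FTTx (L : FirstOrder.Language) {M : Type*} [L.Structure M] {k : ℕ} {ι : Type*}
    (Ω : Set ι) (I : ι → Set (Fin k → M)) : Prop :=
  ∃ P : Set (Set (Set (Fin k → M))), P.Finite ∧ (∀ p ∈ P, GoodT L p) ∧ ∀ u ∈ Ω, ∃ p ∈ P, I u ∈ p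

theorem FTTx.mono {ι : Type*} {Ω Ω' : Set ι} {I : ι → Set (Fin k → M)} (h : FTTx L Ω I)
    (hs : Ω' ⊆ Ω) : FTTx L Ω' I := by
  obtain ⟨P, h1, h2, h3⟩ := h
  exact ⟨P, h1, h2, fun u hu => h3 u (hs hu)⟩

theorem FTTx.union {ι : Type*} {Ω Ω' : Set ι} {I : ι → Set (Fin k → M)} (h : FTTx L Ω I)
    (h' : FTTx L Ω' I) : FTTx L (Ω ∪ Ω') I := by
  obtain ⟨P, h1, h2, h3⟩ := h
  obtain ⟨P', h1', h2', h3'⟩ := h'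
  refine ⟨P ∪ P', h1.union h1', ?_, ?_⟩
  · rintro p (hp | hp)
    · exact h2 p hp
    · exact h2' p hp
  · rintro u (hu | hu)
    · obtain ⟨p, hp, h⟩ := h3 u hu
      exact ⟨p, Or.inl hp, h⟩
    · obtain ⟨p, hp, h⟩ := h3' u hu
      exact ⟨p, Or.inr hp, h⟩

theorem exists_ultra {ι : Type*} {Ω : Set ι} {I : ι → Set (Fin k → M)} (h : ¬ FTTx L Ω I) :
    ∃ U : Ultrafilter ι, (∀ᶠ v in U, v ∈ Ω) ∧
      ∀ Ω' ⊆ Ω, FTTx L Ω' I → ∀ᶠ v in U, v ∉ Ω' := by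
  let F : Filter ι :=
    { sets := {A | FTTx L (Ω \ A) I}
      univ_sets := ⟨∅, finite_empty, by simp, by simp⟩
      sets_of_superset := fun {A B} hA hAB => hA.mono (diff_subset_diff_right hAB)
      inter_sets := fun {A B} hA hB => by
        show FTTx L (Ω \ (A ∩ B)) I
        rw [diff_inter]
        exact FTTx.union hA hB }
  have hF : F.NeBot := by
    rw [Filter.neBot_iff]
    intro hb
    have h1 : (∅ : Set ι) ∈ F := by rw [hb]; exact Filter.mem_bot
    have h2 : FTTx L (Ω \ ∅) I := h1
    rw [diff_empty] at h2
    exact h h2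
  refine ⟨Ultrafilter.of F, ?_, ?_⟩
  · refine Ultrafilter.of_le F ?_
    show FTTx L (Ω \ Ω) I
    rw [diff_self]
    exact ⟨∅, finite_empty, by simp, by simp⟩
  · intro Ω' hs hf
    refine Ultrafilter.of_le F ?_
    show FTTx L (Ω \ {v | v ∉ Ω'}) I
    exact hf.mono fun v hv => not_not.1 hv.2

end Comb

section Claim

variable {L : FirstOrder.Language} {M : Type*} [L.Structure M] [LinearOrder M] {k : ℕ}
    {X : Set (Fin k → M)} {r : (Fin k → M) → (Fin k → M) → Prop}

theorem cofX (hM : IsOMinimal L M) (hp : DPre L X r) {B : Set (Fin k → M)} (hBX : B ⊆ X)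
    (hB : Dfn L (fun v : Fin k → M => v ∈ B)) (hne : B.Nonempty) :
    ∃ p, GoodT L p ∧ ∀ y ∈ B, {x | x ∈ B ∧ r y x} ∈ p :=
  cofT hM B r hB hp.dr (fun x hx => hp.refl x (hBX hx))
    (fun x hx y hy z hz => hp.trans x (hBX hx) y (hBX hy) z (hBX hz))
    (fun x hx y hy => hp.total x (hBX hx) y (hBX hy)) hne

theorem coinX (hM : IsOMinimal L M) (hp : DPre L X r) {B : Set (Fin k → M)} (hBX : B ⊆ X)
    (hB : Dfn L (fun v : Fin k → M => v ∈ B)) (hne : B.Nonempty) :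
    ∃ p, GoodT L p ∧ ∀ y ∈ B, {x | x ∈ B ∧ r x y} ∈ p :=
  cofT hM B (fun x y => r y x) hB (hp.dr.sub2 (TMap.id.comp _) (TMap.id.comp _))
    (fun x hx => hp.refl x (hBX hx))
    (fun x hx y hy z hz h1 h2 => hp.trans z (hBX hz) y (hBX hy) x (hBX hx) h2 h1)
    (fun x hx y hy => hp.total y (hBX hy) x (hBX hx)) hne

theorem dfn_single (hM : IsOMinimal L M) (x : Fin k → M) :
    Dfn L (fun v : Fin k → M => v ∈ ({x} : Set (Fin k → M))) := by
  have h : Dfn L (fun v : Fin k → M => ∀ i, ¬ v i < x i ∧ ¬ x i < v i) := by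
    refine Dfn.allFin fun i => ?_
    exact (dfn_lt hM (IsTm.v i) (Or.inr ⟨x i, fun _ => rfl⟩)).not.and
      (dfn_lt hM (Or.inr ⟨x i, fun _ => rfl⟩) (IsTm.v i)).not
  refine h.congr fun v => ?_
  rw [mem_singleton_iff]
  constructor
  · intro h
    funext i
    exact le_antisymm (not_lt.1 (h i).2) (not_lt.1 (h i).1)
  · rintro rfl i
    exact ⟨lt_irrefl _, lt_irrefl _⟩

theorem ptU (hM : IsOMinimal L M) (hp : DPre L X r) {ι : Type*} {U : Filter ι}
    {I : ι → Set (Fin k → M)} (hU : ∀ p, GoodT L p → ∀ᶠ v in U, I v ∉ p)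
    {x : Fin k → M} (hx : x ∈ X) : ∀ᶠ v in U, x ∉ I v := by
  obtain ⟨p, hg, h⟩ := cofX hM hp (singleton_subset_iff.2 hx) (dfn_single hM x)
    (singleton_nonempty x)
  filter_upwards [hU p hg] with v hv hxv
  refine hv (hg.pf.mono _ (h x rfl) _ ?_)
  rintro y ⟨hy, -⟩
  rw [mem_singleton_iff] at hy
  exact hy ▸ hxv

theorem strongU (hM : IsOMinimal L M) (hp : DPre L X r) {ι : Type*} {U : Filter ι}
    {I : ι → Set (Fin k → M)} (hU : ∀ p, GoodT L p → ∀ᶠ v in U, I v ∉ p)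
    {K : Set (Fin k → M)} (hK : OC X r K) (hKd : Dfn L (fun v : Fin k → M => v ∈ K)) :
    ∀ᶠ v in U, ∀ g, OC X r g → g ⊆ I v → (g ∩ K).Nonempty → g ⊆ K := by
  have h1 : ∀ᶠ v in U, ∀ g, OC X r g → g ⊆ I v → (g ∩ K).Nonempty →
      ∀ w ∈ g, ¬ ∀ k' ∈ K, ¬ r k' w := by
    set B : Set (Fin k → M) := {x | x ∈ X ∧ ∀ k', k' ∈ K → ¬ r k' x} with hBdef
    have hB : Dfn L (fun v : Fin k → M => v ∈ B) := by
      refine hp.dX.and (Dfn.all (Dfn.imp ?_ (Dfn.not ?_)))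
      · exact hKd.subst (TMap.id.comp _)
      · exact hp.dr.sub2 (TMap.id.comp _) (TMap.id.comp _)
    have hBX : B ⊆ X := fun x hx => hx.1
    by_cases hne : B.Nonempty
    · obtain ⟨p, hg, h⟩ := cofX hM hp hBX hB hne
      filter_upwards [hU p hg] with v hv g hgo hgv hgK w hw hwK
      have hwB : w ∈ B := ⟨hgo.1 hw, hwK⟩
      obtain ⟨y, hyg, hyK⟩ := hgK
      refine hv (hg.pf.mono _ (h w hwB) _ ?_)
      rintro x ⟨hxB, hwx⟩
      refine hgv (hgo.2 w hw y hyg x hxB.1 hwx ?_)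
      exact (hp.total x hxB.1 y (hK.1 hyK)).resolve_right (hxB.2 y hyK)
    · refine Filter.Eventually.of_forall fun v g hgo hgv hgK w hw hwK => ?_
      exact hne ⟨w, hgo.1 hw, hwK⟩
  have h2 : ∀ᶠ v in U, ∀ g, OC X r g → g ⊆ I v → (g ∩ K).Nonempty →
      ∀ w ∈ g, ¬ ∀ k' ∈ K, ¬ r w k' := by
    set B : Set (Fin k → M) := {x | x ∈ X ∧ ∀ k', k' ∈ K → ¬ r x k'} with hBdef
    have hB : Dfn L (fun v : Fin k → M => v ∈ B) := by
      refine hp.dX.and (Dfn.all (Dfn.imp ?_ (Dfn.not ?_)))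
      · exact hKd.subst (TMap.id.comp _)
      · exact hp.dr.sub2 (TMap.id.comp _) (TMap.id.comp _)
    have hBX : B ⊆ X := fun x hx => hx.1
    by_cases hne : B.Nonempty
    · obtain ⟨p, hg, h⟩ := coinX hM hp hBX hB hne
      filter_upwards [hU p hg] with v hv g hgo hgv hgK w hw hwK
      have hwB : w ∈ B := ⟨hgo.1 hw, hwK⟩
      obtain ⟨y, hyg, hyK⟩ := hgK
      refine hv (hg.pf.mono _ (h w hwB) _ ?_)
      rintro x ⟨hxB, hwx⟩
      refine hgv (hgo.2 y hyg w hw x hxB.1 ?_ hwx)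
      exact (hp.total x hxB.1 y (hK.1 hyK)).resolve_left (hxB.2 y hyK)
    · refine Filter.Eventually.of_forall fun v g hgo hgv hgK w hw hwK => ?_
      exact hne ⟨w, hgo.1 hw, hwK⟩
  filter_upwards [h1, h2] with v h1 h2 g hgo hgv hgK w hw
  have a1 := h1 g hgo hgv hgK w hw
  have a2 := h2 g hgo hgv hgK w hw
  push Not at a1 a2
  obtain ⟨a, ha, haw⟩ := a1
  obtain ⟨b, hb, hwb⟩ := a2
  exact hK.2 a ha b hb w (hgo.1 hw) haw hwb

/-- Step of the inner induction. -/
theorem stepP (hM : IsOMinimal L M) (hp : DPre L X r) {m l : ℕ} {U : Ultrafilter (Fin m → M)}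
    {I : (Fin m → M) → Set (Fin k → M)} (hU : ∀ p, GoodT L p → ∀ᶠ v in U, I v ∉ p)
    (hI : DF L I) (j : ℕ) {W : Set (Fin m → M)} (hW : Dfn L (fun v : Fin m → M => v ∈ W))
    (hWU : ∀ᶠ v in U, v ∈ W) (hCN : ∀ u ∈ W, CN L X r (l + 1) (I u))
    (hmeet : ∀ u ∈ W, ∀ᶠ v in U, (rit X r j (I v) ∩ I u).Nonempty)
    (IH : ∀ Ω ⊆ W, Dfn L (fun v : Fin m → M => v ∈ Ω) →
      (∀ u ∈ Ω, (rit X r (j + 1) (I u)).Nonempty) →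
      (¬ ∃ f : ℕ → (Fin m → M), (∀ i, f i ∈ Ω) ∧ ∀ i i', i < i' →
        ∀ w, w ∈ rit X r (j + 1) (I (f i)) → ¬ w ∈ rit X r (j + 1) (I (f i'))) →
      ∀ᶠ v in U, v ∉ Ω) :
    ∃ W' ⊆ W, Dfn L (fun v : Fin m → M => v ∈ W') ∧ (∀ᶠ v in U, v ∈ W') ∧
      ∀ u ∈ W', ∀ᶠ v in U, (rit X r (j + 1) (I v) ∩ I u).Nonempty := by
  classical
  have hsub : ∀ u ∈ W, I u ⊆ X := fun u hu => (hCN u hu).sub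
  obtain ⟨u0, hu0⟩ := hWU.exists
  have hrne : ∀ᶠ v in U, (rit X r j (I v)).Nonempty :=
    (hmeet u0 hu0).mono fun v hv => hv.mono inter_subset_left
  set C : Set (Fin k → M) := {x | x ∈ X ∧ ∀ᶠ v in U, ∀ y ∈ rit X r j (I v), ¬ r y x} with hCdef
  have hCX : C ⊆ X := fun x hx => hx.1
  -- points outside C are above the first component
  have hnC : ∀ x ∈ X, x ∉ C → ∀ᶠ v in U, ∀ f ∈ fst X r (rit X r j (I v)), ¬ r x f := by
    intro x hx hxC
    have h1 : ∀ᶠ v in U, ∃ y ∈ rit X r j (I v), r y x := by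
      have : ¬ ∀ᶠ v in U, ∀ y ∈ rit X r j (I v), ¬ r y x := fun h => hxC ⟨hx, h⟩
      rw [← Ultrafilter.eventually_not] at this
      refine this.mono fun v hv => ?_
      push Not at hv
      exact hv
    filter_upwards [h1, ptU hM hp hU hx] with v ⟨y, hy, hyx⟩ hxv f hf hxf
    exact hxv (rit_sub j _ (hf.2 y hy x hx hyx hxf))
  let Oz : (Fin k → M) → Set (Fin m → M) := fun z =>
    {u | u ∈ W ∧ ∀ w, w ∈ I u → r z w → w ∈ rit X r (j + 1) (I u)}
  let Tup : (Fin k → M) → Prop := fun z => ∃ u : Fin (l + 2) × Fin m → M,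
    (∀ n, u ∘ Prod.mk n ∈ Oz z) ∧ ∀ n n' : Fin (l + 2), n ≠ n' → ∀ w : Fin k → M,
      w ∈ rit X r (j + 1) (I (u ∘ Prod.mk n)) → ¬ w ∈ rit X r (j + 1) (I (u ∘ Prod.mk n'))
  have hT1 : ∀ z ∈ C, ¬ Tup z := by
    rintro z ⟨hzX, hz⟩ ⟨u, huO, hdis⟩
    have hall : ∀ᶠ v in U, ∀ n, ∀ g, OC X r g → g ⊆ I v → (g ∩ I (u ∘ Prod.mk n)).Nonempty →
        g ⊆ I (u ∘ Prod.mk n) := by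
      rw [Filter.eventually_all]
      intro n
      obtain ⟨T, -, hT, hTe⟩ := hCN _ (huO n).1
      have : ∀ᶠ v in U, ∀ K ∈ T, ∀ g, OC X r g → g ⊆ I v → (g ∩ K).Nonempty → g ⊆ K := by
        rw [Filter.eventually_all_finset]
        exact fun K hK => strongU hM hp hU (hT K hK).1 (hT K hK).2
      filter_upwards [this] with v hv g hgo hgv hgI
      rw [hTe] at hgI ⊢
      obtain ⟨x, hxg, K, hK, hxK⟩ := hgI
      exact (hv K hK g hgo hgv ⟨x, hxg, hxK⟩).trans (subset_sUnion_of_mem hK)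
    have hm2 : ∀ᶠ v in U, ∀ n, (rit X r j (I v) ∩ I (u ∘ Prod.mk n)).Nonempty := by
      rw [Filter.eventually_all]
      exact fun n => hmeet _ (huO n).1
    obtain ⟨v, h1, h2, h3, h4⟩ := (hall.and (hm2.and (hz.and hWU))).exists
    obtain ⟨T, hTc, hT, hTe⟩ := rit_CN hp (hCN v h4) j
    have hex : ∀ n, ∃ g ∈ T, g ⊆ I (u ∘ Prod.mk n) ∧ g.Nonempty := by
      intro n
      obtain ⟨x, hx, hxI⟩ := h2 n
      rw [hTe] at hx
      obtain ⟨g, hg, hxg⟩ := hx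
      refine ⟨g, hg, h1 n g (hT g hg).1 ?_ ⟨x, hxg, hxI⟩, ⟨x, hxg⟩⟩
      refine (subset_sUnion_of_mem hg).trans ?_
      rw [← hTe]
      exact rit_sub j _
    choose G hGT hGI hGne using hex
    obtain ⟨n, -, n', -, hnn, hG⟩ := Finset.exists_ne_map_eq_of_card_lt_of_maps_to
      (s := (Finset.univ : Finset (Fin (l + 2)))) (t := T) (f := G)
      (by rw [Finset.card_univ, Fintype.card_fin]; omega) (fun n _ => hGT n)
    obtain ⟨w, hw⟩ := hGne n
    have hwr : w ∈ rit X r j (I v) := by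
      rw [hTe]
      exact ⟨G n, hGT n, hw⟩
    have hzw : r z w := (hp.total z hzX w ((hT _ (hGT n)).1.1 hw)).resolve_right (h3 w hwr)
    have hw' : w ∈ G n' := hG ▸ hw
    exact hdis n n' hnn w ((huO n).2 w (hGI n hw) hzw) ((huO n').2 w (hGI n' hw') hzw)
  have hOzd : ∀ z, Dfn L (fun u : Fin m → M => u ∈ Oz z) := by
    intro z
    refine hW.and (Dfn.all (Dfn.imp ?_ (Dfn.imp ?_ ?_)))
    · exact hI.app (TMap.id.comp _) (TMap.id.comp _)
    · exact hp.dr.sub2 (TMap.const _) (TMap.id.comp _)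
    · exact (DF.rit hp hI (j + 1)).app (TMap.id.comp _) (TMap.id.comp _)
  have hT2 : ∀ z ∈ X, z ∉ C → Tup z := by
    intro z hz hzC
    by_contra hnT
    have hin : ∀ᶠ v in U, v ∈ Oz z := by
      filter_upwards [hnC z hz hzC, hWU, hrne] with v hv hvW hne
      refine ⟨hvW, fun w hw hzw => ?_⟩
      have hritX : rit X r j (I v) ⊆ X := (rit_sub j _).trans (hsub v hvW)
      have hwX := hsub v hvW hw
      refine ⟨?_, fun hwf => hv w hwf hzw⟩
      obtain ⟨f, hf⟩ := fst_nonempty hp (rit_CN hp (hCN v hvW) j) hne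
      have hfX := hritX hf.1
      have hfz : r f z := (hp.total z hz f hfX).resolve_left (hv f hf)
      exact rit_up hp j (hsub v hvW) f hf.1 w hw (hp.trans f hfX z hz w hwX hfz hzw)
    have hout := IH (Oz z) (fun u hu => hu.1) (hOzd z) ?_ ?_
    · obtain ⟨v, h1, h2⟩ := (hin.and hout).exists
      exact h2 h1
    · intro u hu
      by_contra hne
      rw [not_nonempty_iff_eq_empty] at hne
      refine hnT ⟨fun q => u q.2, fun n => hu, fun n n' _ w hw => ?_⟩
      have hw' : w ∈ rit X r (j + 1) (I u) := hw
      rw [hne] at hw'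
      exact absurd hw' (notMem_empty w)
    · rintro ⟨f, hf, hd⟩
      refine hnT ⟨fun q => f q.1 q.2, fun n => hf n, fun n n' hnn w hw hw' => ?_⟩
      have e1 : w ∈ rit X r (j + 1) (I (f n)) := hw
      have e2 : w ∈ rit X r (j + 1) (I (f n')) := hw'
      have hne : (n : ℕ) ≠ n' := fun h => hnn (Fin.ext h)
      rcases lt_or_gt_of_ne hne with h | h
      · exact hd _ _ h w e1 e2
      · exact hd _ _ h w e2 e1
  have hTupd : Dfn L Tup := by
    refine Dfn.ex (Dfn.and (Dfn.allFin fun n => ?_) (Dfn.allFin fun n => Dfn.allFin fun n' =>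
      Dfn.imp (Dfn.prop _) (Dfn.all (Dfn.imp ?_ (Dfn.not ?_)))))
    · refine Dfn.and (hW.subst ((TMap.id.comp _).comp _)) (Dfn.all (Dfn.imp ?_ (Dfn.imp ?_ ?_)))
      · exact hI.app (((TMap.id.comp _).comp _).comp _) (TMap.id.comp _)
      · exact hp.dr.sub2 ((TMap.id.comp _).comp _) (TMap.id.comp _)
      · exact (DF.rit hp hI (j + 1)).app (((TMap.id.comp _).comp _).comp _) (TMap.id.comp _)
    · exact (DF.rit hp hI (j + 1)).app (((TMap.id.comp _).comp _).comp _) (TMap.id.comp _)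
    · exact (DF.rit hp hI (j + 1)).app (((TMap.id.comp _).comp _).comp _) (TMap.id.comp _)
  have hCd : Dfn L (fun z : Fin k → M => z ∈ C) := by
    refine (hp.dX.and hTupd.not).congr fun z => ⟨fun h => ?_, fun h => ⟨hCX h, hT1 z h⟩⟩
    by_contra hzC
    exact h.2 (hT2 z h.1 hzC)
  -- the two types
  obtain ⟨W1, hW1d, hW1U, hW1⟩ : ∃ W1 : Set (Fin m → M), Dfn L (fun v : Fin m → M => v ∈ W1) ∧
      (∀ᶠ v in U, v ∈ W1) ∧ ∀ u ∈ W1, ∀ y ∈ C, ¬ {x | x ∈ C ∧ r y x} ⊆ I u := by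
    by_cases hne : C.Nonempty
    · obtain ⟨p, hg, h⟩ := cofX hM hp hCX hCd hne
      refine ⟨{u | I u ∉ p}, ?_, hU p hg, ?_⟩
      · exact (hg.dfn (Fin m) (fun u w => w ∈ I u) hI).not
      · intro u hu y hy hs
        exact hu (hg.pf.mono _ (h y hy) _ hs)
    · exact ⟨univ, Dfn.congr (Dfn.prop True) fun v => by simp, by simp,
        fun u _ y hy => absurd ⟨y, hy⟩ hne⟩
  obtain ⟨W2, hW2d, hW2U, hW2⟩ : ∃ W2 : Set (Fin m → M), Dfn L (fun v : Fin m → M => v ∈ W2) ∧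
      (∀ᶠ v in U, v ∈ W2) ∧ ∀ u ∈ W2, ∀ y ∈ X, y ∉ C →
        ¬ {x | (x ∈ X ∧ ¬ x ∈ C) ∧ r x y} ⊆ I u := by
    by_cases hne : ({x | x ∈ X ∧ ¬ x ∈ C} : Set (Fin k → M)).Nonempty
    · obtain ⟨p, hg, h⟩ := coinX hM hp (B := {x | x ∈ X ∧ ¬ x ∈ C}) (fun x hx => hx.1)
        (hp.dX.and hCd.not) hne
      refine ⟨{u | I u ∉ p}, ?_, hU p hg, ?_⟩
      · exact (hg.dfn (Fin m) (fun u w => w ∈ I u) hI).not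
      · intro u hu y hy hyC hs
        exact hu (hg.pf.mono _ (h y ⟨hy, hyC⟩) _ hs)
    · exact ⟨univ, Dfn.congr (Dfn.prop True) fun v => by simp, by simp,
        fun u _ y hy hyC => absurd ⟨y, hy, hyC⟩ hne⟩
  refine ⟨{u | u ∈ W ∧ u ∈ W1 ∧ u ∈ W2}, fun u hu => hu.1, hW.and (hW1d.and hW2d),
    hWU.and (hW1U.and hW2U), ?_⟩
  rintro u ⟨huW, hu1, hu2⟩
  by_contra hcon
  rw [← Ultrafilter.eventually_not] at hcon
  obtain ⟨T, -, hT, hTe⟩ := hCN u huW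
  have hst : ∀ᶠ v in U, ∀ K ∈ T, ∀ g, OC X r g → g ⊆ I v → (g ∩ K).Nonempty → g ⊆ K := by
    rw [Filter.eventually_all_finset]
    exact fun K hK => strongU hM hp hU (hT K hK).1 (hT K hK).2
  have hK : ∀ᶠ v in U, ∃ K ∈ T, fst X r (rit X r j (I v)) ⊆ K ∧
      (fst X r (rit X r j (I v))).Nonempty := by
    filter_upwards [hcon, hst, hmeet u huW, hWU] with v hv1 hv2 hv3 hvW
    obtain ⟨x, hx, hxu⟩ := hv3
    have hxf : x ∈ fst X r (rit X r j (I v)) := by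
      by_contra hxf
      exact hv1 ⟨x, ⟨hx, hxf⟩, hxu⟩
    rw [hTe] at hxu
    obtain ⟨K, hK, hxK⟩ := hxu
    refine ⟨K, hK, hv2 K hK _ (fst_oc hp ((rit_sub j _).trans (hsub v hvW))) ?_ ⟨x, hxf, hxK⟩,
      ⟨x, hxf⟩⟩
    exact fun y hy => rit_sub j _ hy.1
  have hK' : ∃ K ∈ T, ∀ᶠ v in U, fst X r (rit X r j (I v)) ⊆ K ∧
      (fst X r (rit X r j (I v))).Nonempty := by
    by_contra hno
    have : ∀ᶠ v in U, ∀ K ∈ T, ¬ (fst X r (rit X r j (I v)) ⊆ K ∧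
        (fst X r (rit X r j (I v))).Nonempty) := by
      rw [Filter.eventually_all_finset]
      intro K hK
      rw [Ultrafilter.eventually_not]
      exact fun h => hno ⟨K, hK, h⟩
    obtain ⟨v, ⟨K, hKT, h1⟩, h2⟩ := (hK.and this).exists
    exact h2 K hKT h1
  obtain ⟨K, hKT, hKU⟩ := hK'
  have hKo := (hT K hKT).1
  have hKI : K ⊆ I u := by
    rw [hTe]
    exact subset_sUnion_of_mem hKT
  by_cases hKC : (K ∩ C).Nonempty
  · obtain ⟨y, hyK, hyC⟩ := hKC
    refine hW1 u hu1 y hyC ?_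
    rintro x ⟨hxC, hyx⟩
    obtain ⟨v, ⟨h1, f, hf⟩, h2⟩ := (hKU.and hxC.2).exists
    have hfK := h1 hf
    refine hKI (hKo.2 y hyK f hfK x hxC.1 hyx ?_)
    exact (hp.total x hxC.1 f (hKo.1 hfK)).resolve_right (h2 f hf.1)
  · obtain ⟨v0, h1, k0, hk0⟩ := hKU.exists
    have hk0K := h1 hk0
    have hk0C : k0 ∉ C := fun h => hKC ⟨k0, hk0K, h⟩
    refine hW2 u hu2 k0 (hKo.1 hk0K) hk0C ?_
    rintro x ⟨⟨hxX, hxC⟩, hxk⟩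
    obtain ⟨v, ⟨h1, f, hf⟩, h2⟩ := (hKU.and (hnC x hxX hxC)).exists
    have hfK := h1 hf
    refine hKI (hKo.2 f hfK k0 hk0K x hxX ?_ hxk)
    exact (hp.total x hxX f (hKo.1 hfK)).resolve_left (h2 f hf)

theorem reduce {ι : Type*} {I : ι → Set (Fin k → M)} {Ω : Set ι} (D : Set ι → Prop)
    (hD : ∀ Ω', D Ω' → ∀ u, D {v | v ∈ Ω' ∧ ∀ w, w ∈ I u → ¬ w ∈ I v}) (hΩ : D Ω)
    (hF : ¬ FTTx L Ω I)
    (hno : ¬ ∃ f : ℕ → ι, (∀ i, f i ∈ Ω) ∧ ∀ i i', i < i' →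
        ∀ w, w ∈ I (f i) → ¬ w ∈ I (f i')) :
    ∃ Ω' ⊆ Ω, D Ω' ∧ ¬ FTTx L Ω' I ∧
      ∀ u ∈ Ω', FTTx L {v | v ∈ Ω' ∧ ∀ w, w ∈ I u → ¬ w ∈ I v} I := by
  by_contra hcon
  push Not at hcon
  let Q := {Ω' : Set ι // Ω' ⊆ Ω ∧ D Ω' ∧ ¬ FTTx L Ω' I}
  have hstep : ∀ q : Q, ∃ u ∈ q.1, ¬ FTTx L {v | v ∈ q.1 ∧ ∀ w, w ∈ I u → ¬ w ∈ I v} I :=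
    fun q => hcon q.1 q.2.1 q.2.2.1 q.2.2.2
  choose g hg hgF using hstep
  let nx : Q → Q := fun q => ⟨{v | v ∈ q.1 ∧ ∀ w, w ∈ I (g q) → ¬ w ∈ I v},
    fun v hv => q.2.1 hv.1, hD _ q.2.2.1 _, hgF q⟩
  let s : ℕ → Q := fun n => nx^[n] ⟨Ω, subset_rfl, hΩ, hF⟩
  have hs : ∀ n, s (n + 1) = nx (s n) := fun n => Function.iterate_succ_apply' _ _ _
  have hanti : ∀ n d, (s (n + d)).1 ⊆ (s n).1 := by
    intro n d
    induction d with
    | zero => exact subset_rfl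
    | succ d ih =>
      rw [← add_assoc, hs]
      exact fun v hv => ih hv.1
  refine hno ⟨fun n => g (s n), fun n => (s n).2.1 (hg _), fun i i' hii => ?_⟩
  obtain ⟨d, rfl⟩ := Nat.exists_eq_add_of_lt hii
  have h1 := hg (s (i + d + 1))
  have h2 : g (s (i + d + 1)) ∈ (s (i + 1)).1 := by
    have := hanti (i + 1) d
    rw [show i + 1 + d = i + d + 1 by omega] at this
    exact this h1
  rw [hs] at h2
  exact h2.2

theorem claim (hM : IsOMinimal L M) (hp : DPre L X r) {m : ℕ} (l : ℕ) :
    ∀ (I : (Fin m → M) → Set (Fin k → M)) (Ω : Set (Fin m → M)), DF L I →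
    Dfn L (fun v : Fin m → M => v ∈ Ω) → (∀ u ∈ Ω, (I u).Nonempty ∧ CN L X r l (I u)) →
    (¬ ∃ f : ℕ → (Fin m → M), (∀ i, f i ∈ Ω) ∧ ∀ i i', i < i' →
        ∀ w, w ∈ I (f i) → ¬ w ∈ I (f i')) → FTTx L Ω I := by
  have hCN0 : ∀ J, CN L X r 0 J → ¬ J.Nonempty := by
    rintro J ⟨T, hc, -, rfl⟩ ⟨x, K, hK, -⟩
    have : T = ∅ := Finset.card_eq_zero.1 (by omega)
    rw [this] at hK
    simp at hK
  induction l with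
  | zero =>
    intro I Ω _ _ h _
    exact ⟨∅, finite_empty, by simp, fun u hu => absurd (h u hu).1 (hCN0 _ (h u hu).2)⟩
  | succ l ih =>
    intro I Ω hI hΩ h hno
    by_contra hF
    obtain ⟨Ω', hs, hΩ', hF', hred⟩ := reduce (L := L) (I := I)
      (fun Ω' : Set (Fin m → M) => Dfn L (fun v : Fin m → M => v ∈ Ω'))
      (fun Ω' hd u => by
        refine hd.and (Dfn.all (Dfn.imp ?_ (Dfn.not ?_)))
        · exact hI.app (TMap.const _) (TMap.id.comp _)
        · exact hI.app (TMap.id.comp _) (TMap.id.comp _)) hΩ hF hno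
    obtain ⟨U, hU1, hU2⟩ := exists_ultra hF'
    have hU : ∀ p, GoodT L p → ∀ᶠ v in U, I v ∉ p := by
      intro p hg
      have := hU2 {v | v ∈ Ω' ∧ I v ∈ p} (fun v hv => hv.1)
        ⟨{p}, finite_singleton p, by rintro q rfl; exact hg, fun u hu => ⟨p, rfl, hu.2⟩⟩
      filter_upwards [this, hU1] with v h1 h2 h3
      exact h1 ⟨h2, h3⟩
    have hP : ∀ j, ∃ W ⊆ Ω', Dfn L (fun v : Fin m → M => v ∈ W) ∧ (∀ᶠ v in U, v ∈ W) ∧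
        ∀ u ∈ W, ∀ᶠ v in U, (rit X r j (I v) ∩ I u).Nonempty := by
      intro j
      induction j with
      | zero =>
        refine ⟨Ω', subset_rfl, hΩ', hU1, fun u hu => ?_⟩
        filter_upwards [hU2 _ (fun v hv => hv.1) (hred u hu), hU1] with v h1 h2
        by_contra hne
        exact h1 ⟨h2, fun w hw hw' => hne ⟨w, hw', hw⟩⟩
      | succ j ihj =>
        obtain ⟨W, hWs, hWd, hWU, hWm⟩ := ihj
        have key := stepP hM hp hU hI j (l := l) hWd hWU
          (fun u hu => (h u (hs (hWs hu))).2) hWm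
        obtain ⟨W', hs', hd', hU', hm'⟩ := key (by
          intro O hO hOd hOne hOno
          refine hU2 O (hO.trans hWs) ?_
          have hOC : ∀ u ∈ O, CN L X r l (rit X r (j + 1) (I u)) := by
            intro u hu
            obtain ⟨T, hTc, hT⟩ := rit_CN hp (h u (hs (hWs (hO hu)))).2 (j + 1)
            exact ⟨T, by omega, hT⟩
          obtain ⟨P, hP1, hP2, hP3⟩ := ih (fun u => rit X r (j + 1) (I u)) O
            (DF.rit hp hI (j + 1)) hOd (fun u hu => ⟨hOne u hu, hOC u hu⟩) hOno
          refine ⟨P, hP1, hP2, fun u hu => ?_⟩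
          obtain ⟨p, hpP, hmem⟩ := hP3 u hu
          exact ⟨p, hpP, (hP2 p hpP).pf.mono _ hmem _ (rit_sub _ _)⟩)
        exact ⟨W', hs'.trans hWs, hd', hU', hm'⟩
    obtain ⟨W, hWs, hWd, hWU, hWm⟩ := hP (l + 1)
    obtain ⟨u, hu⟩ := hWU.exists
    obtain ⟨v, hv, hvW⟩ := ((hWm u hu).and hWU).exists
    have := rit_CN hp (h v (hs (hWs hvW))).2 (l + 1)
    rw [Nat.sub_self] at this
    exact hCN0 _ this (hv.mono inter_subset_left)

end Claim

section Final

theorem GoodT.isType {L : FirstOrder.Language} {M : Type*} [L.Structure M] {k : ℕ}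
    {p : Set (Set (Fin k → M))} (hg : GoodT L p) :
    IsTypeOn L k {Y | Set.Definable (Set.univ : Set M) L Y ∧ Y ∈ p} ∧
      IsDefTypeOver L (Set.univ : Set M) k {Y | Set.Definable (Set.univ : Set M) L Y ∧ Y ∈ p} := by
  refine ⟨⟨fun Y hY => hY.1, fun h => hg.pf.nemp h.2, ?_, ?_, ?_⟩, ?_⟩
  · exact fun Y hY Z hZ => ⟨hY.1.inter hZ.1, hg.pf.inter _ hY.2 _ hZ.2⟩
  · exact fun Y hY Z hZ hs => ⟨hZ, hg.pf.mono _ hY.2 _ hs⟩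
  · intro Y hY
    rcases hg.dec Y hY with h | h
    · exact Or.inl ⟨hY, h⟩
    · exact Or.inr ⟨hY.compl, h⟩
  · intro m D hD
    have hD' : Dfn L (fun z : Fin m ⊕ Fin k → M => z ∈ D) := hD.mono (empty_subset _)
    have h1 := hg.dfn (Fin m) (fun u w => Sum.elim u w ∈ D)
      (hD'.subst ((TMap.id.comp _).sum (TMap.id.comp _)))
    refine Dfn.congr h1 fun u => ⟨fun h => ⟨?_, h⟩, fun h => h.2⟩
    exact hD'.subst ((TMap.const u).sum TMap.id)

theorem interval_oc {L : FirstOrder.Language} {M : Type*} [L.Structure M] {k : ℕ}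
    {X : Set (Fin k → M)} {r : (Fin k → M) → (Fin k → M) → Prop} (hp : DPre L X r)
    {K : Set (Fin k → M)} (hK : PreorderInterval X r K) :
    OC X r K ∧ Dfn L (fun v : Fin k → M => v ∈ K) := by
  obtain ⟨c, d, hc, hd, rfl⟩ := hK
  have hc1 : Dfn L (fun v : Fin k → M => v ∈ c) := by
    rcases hc with rfl | ⟨x, -, rfl⟩ | ⟨x, -, rfl⟩
    · exact Dfn.congr (Dfn.prop True) fun v => by simp
    · exact hp.dr.sub2 (TMap.const x) TMap.id
    · exact (hp.dr.sub2 (TMap.const x) TMap.id).and (hp.dr.sub2 TMap.id (TMap.const x)).not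
  have hd1 : Dfn L (fun v : Fin k → M => v ∈ d) := by
    rcases hd with rfl | ⟨x, -, rfl⟩ | ⟨x, -, rfl⟩
    · exact Dfn.congr (Dfn.prop True) fun v => by simp
    · exact hp.dr.sub2 TMap.id (TMap.const x)
    · exact (hp.dr.sub2 TMap.id (TMap.const x)).and (hp.dr.sub2 (TMap.const x) TMap.id).not
  refine ⟨⟨fun x hx => hx.1.1, ?_⟩, (hp.dX.and hc1).and hd1⟩
  rintro a ⟨⟨haX, hac⟩, -⟩ b ⟨⟨hbX, -⟩, hbd⟩ x hx hax hxb
  refine ⟨⟨hx, ?_⟩, ?_⟩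
  · rcases hc with rfl | ⟨y, hy, rfl⟩ | ⟨y, hy, rfl⟩
    · trivial
    · exact hp.trans y hy a haX x hx hac hax
    · exact ⟨hp.trans y hy a haX x hx hac.1 hax,
        fun h => hac.2 (hp.trans a haX x hx y hy hax h)⟩
  · rcases hd with rfl | ⟨y, hy, rfl⟩ | ⟨y, hy, rfl⟩
    · trivial
    · exact hp.trans x hx b hbX y hy hxb hbd
    · exact ⟨hp.trans x hx b hbX y hy hxb hbd.1,
        fun h => hbd.2 (hp.trans y hy x hx b hbX h hxb)⟩

end Final

/-- Lemma on definable preorders: let `(X,≼)` be a definable totally preordered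
subset of `M^k` and `S` a definable family of nonempty subsets of `X`, each a union of at most
`l` `≼`-intervals with endpoints in `X ∪ {±∞}`. Then exactly one of the following holds:
`S` has a finite tame transversal, or `S` has an infinite pairwise disjoint subfamily. -/
theorem statement6 (L : FirstOrder.Language) (M : Type*) [L.Structure M] [LinearOrder M]
    (hM : IsOMinimal L M) (k l : ℕ) (X : Set (Fin k → M)) (D : Set (Fin k ⊕ Fin k → M))
    (hX : Set.Definable (Set.univ : Set M) L X) (hD : Set.Definable (Set.univ : Set M) L D)
    (r : (Fin k → M) → (Fin k → M) → Prop) (hr : ∀ x y, r x y ↔ Sum.elim x y ∈ D)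
    (hrefl : ∀ x ∈ X, r x x)
    (htrans : ∀ x ∈ X, ∀ y ∈ X, ∀ z ∈ X, r x y → r y z → r x z)
    (htotal : ∀ x ∈ X, ∀ y ∈ X, r x y ∨ r y x)
    (S : Set (Set (Fin k → M))) (hS : IsDefFamily L (Set.univ : Set M) k S)
    (hmem : ∀ Y ∈ S, Y.Nonempty ∧ Y ⊆ X ∧ ∃ m ≤ l, ∃ f : Fin m → Set (Fin k → M),
      (∀ i, PreorderInterval X r (f i)) ∧ Y = ⋃ i, f i) :
    Xor' (HasFTT L k S)
      (∃ S' ⊆ S, S'.Infinite ∧ S'.Pairwise fun Y Z => Y ∩ Z = ∅) := by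
  classical
  have hp : DPre L X r := by
    refine ⟨hX, ?_, hrefl, htrans, htotal⟩
    have hD' : Dfn L (fun z : Fin k ⊕ Fin k → M => z ∈ D) := hD
    refine (hD'.subst ((TMap.id.comp Sum.inl).sum (TMap.id.comp Sum.inr))).congr fun z => ?_
    exact (hr _ _).symm
  have hdich : ¬ (HasFTT L k S ∧
      ∃ S' ⊆ S, S'.Infinite ∧ S'.Pairwise fun Y Z => Y ∩ Z = ∅) := by
    rintro ⟨⟨N, p, hpt, hcov⟩, S', hS', hinf, hpw⟩
    have : ∀ Y : S', ∃ i, Y.1 ∈ p i := fun Y => hcov Y.1 (hS' Y.2)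
    choose g hg using this
    haveI := hinf.to_subtype
    obtain ⟨Y, Z, hne, hYZ⟩ := Finite.exists_ne_map_eq_of_infinite g
    have hne' : Y.1 ≠ Z.1 := fun h => hne (Subtype.ext h)
    have h0 := (hpt (g Y)).1.2.2.1 _ (hg Y) _ (hYZ ▸ hg Z)
    rw [hpw Y.2 Z.2 hne'] at h0
    exact (hpt (g Y)).1.2.1 h0
  by_cases h2 : ∃ S' ⊆ S, S'.Infinite ∧ S'.Pairwise fun Y Z => Y ∩ Z = ∅
  · exact Or.inr ⟨h2, fun h1 => hdich ⟨h1, h2⟩⟩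
  · refine Or.inl ⟨?_, h2⟩
    obtain ⟨m, Ω, D', hΩ, hD', rfl⟩ := hS
    have hDd : Dfn L (fun z : Fin m ⊕ Fin k → M => z ∈ D') := hD'
    have hI : DF L (famFiber D') := hDd.subst ((TMap.id.comp Sum.inl).sum (TMap.id.comp Sum.inr))
    have hmem' : ∀ u ∈ Ω, (famFiber D' u).Nonempty ∧ CN L X r l (famFiber D' u) := by
      intro u hu
      obtain ⟨hne, -, m', hm', f, hf, he⟩ := hmem _ (mem_image_of_mem _ hu)
      refine ⟨hne, Finset.univ.image f, ?_, ?_, ?_⟩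
      · exact (Finset.card_image_le).trans (by rw [Finset.card_univ, Fintype.card_fin]; exact hm')
      · intro K hK
        obtain ⟨i, -, rfl⟩ := Finset.mem_image.1 hK
        exact interval_oc hp (hf i)
      · rw [he]
        simp
    obtain ⟨P, hPf, hPg, hPc⟩ := claim hM hp l (famFiber D') Ω hI hΩ hmem' (by
      rintro ⟨f, hf, hd⟩
      have hd2 : ∀ i i', i ≠ i' → famFiber D' (f i) ∩ famFiber D' (f i') = ∅ := by
        intro i i' hii
        rw [eq_empty_iff_forall_notMem]
        rintro w ⟨h1, h1'⟩
        rcases lt_or_gt_of_ne hii with h | h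
        · exact hd _ _ h w h1 h1'
        · exact hd _ _ h w h1' h1
      refine h2 ⟨range fun i => famFiber D' (f i), ?_, ?_, ?_⟩
      · rintro _ ⟨i, rfl⟩
        exact mem_image_of_mem _ (hf i)
      · refine infinite_range_of_injective fun i i' h => ?_
        by_contra hii
        have h3 := hd2 i i' hii
        have h4 : famFiber D' (f i) = famFiber D' (f i') := h
        rw [← h4, inter_self] at h3
        exact (hmem' _ (hf i)).1.ne_empty h3
      · rintro _ ⟨i, rfl⟩ _ ⟨i', rfl⟩ hne
        exact hd2 i i' fun h => hne (by rw [h]))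
    obtain ⟨N, e, -, he⟩ := hPf.fin_param
    refine ⟨N, fun i => {Y | Set.Definable (Set.univ : Set M) L Y ∧ Y ∈ e i},
      fun i => (hPg (e i) (he ▸ mem_range_self i)).isType, ?_⟩
    rintro _ ⟨u, hu, rfl⟩
    obtain ⟨p, hpP, hup⟩ := hPc u hu
    rw [← he] at hpP
    obtain ⟨i, rfl⟩ := hpP
    refine ⟨i, ?_, hup⟩
    exact hDd.subst ((TMap.const u).sum TMap.id)
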